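/- Let X̃_t be the decoherent Hadamard walk starting at |0,1⟩ with 0 < p ≤ 1 and q = 1 − p, and let μ_t = E(X̃_t) = Σ_{x∈ℤ} x·P(X̃_t = x). Then there exist constants d > 0 and C > 0 such that for all t, |μ_t − (√(1+q²) − 1)/p| ≤ C·e^{−dt}. -/

import Mathlib

noncomputable section

open Complex Filter

/-- Amplitude functions on the position × coin space `ℤ × {1,2}`
(coin `0` = "right", coin `1` = "left"). -/
abbrev QState := ℤ × Fin 2 → ℂ

/-- One step of the Hadamard walk: `(hadamardStep ψ) (x,n) = ⟨x,n|U ψ⟩`, where `U = S ∘ C`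
with `S` the chirality-conditioned shift and `C` the Hadamard coin. -/
def hadamardStep (ψ : QState) : QState := fun v =>
  if v.2 = 0 then (ψ (v.1 - 1, 0) + ψ (v.1 - 1, 1)) / (Real.sqrt 2 : ℂ)
  else (ψ (v.1 + 1, 0) - ψ (v.1 + 1, 1)) / (Real.sqrt 2 : ℂ)

/-- The basis state `|x,n⟩`. -/
def ket (x : ℤ) (n : Fin 2) : QState := fun v => if v = (x, n) then 1 else 0

/-- Pure Hadamard-walk probabilities `W_{m,n}(x,t) = |⟨x,n|U^t|0,m⟩|²`. -/
def W (m n : Fin 2) (x : ℤ) (t : ℕ) : ℝ := ‖(hadamardStep^[t] (ket 0 m)) (x, n)‖ ^ 2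

/-- Measurement operators, indexed by `𝔸 = {c} ∪ ℤ×{1,2}`:
`none` is the coherent projection `A_c = √(1-p)·I`, and `some (x,n)` is the
decoherence projection `A_{x,n} = √p |x,n⟩⟨x,n|`. -/
def measOp (p : ℝ) : Option (ℤ × Fin 2) → QState → QState
  | none => fun ψ v => (Real.sqrt (1 - p) : ℂ) * ψ v
  | some w => fun ψ v => if v = w then (Real.sqrt p : ℂ) * ψ w else 0

/-- The amplitude `(A_{j_t}U)⋯(A_{j_1}U)|0,m⟩` along the path `j`. -/
def pathAmp (p : ℝ) (m : Fin 2) : (t : ℕ) → (Fin t → Option (ℤ × Fin 2)) → QState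
  | 0, _ => ket 0 m
  | t + 1, j => measOp p (j (Fin.last t)) (hadamardStep (pathAmp p m t fun i => j i.castSucc))

/-- Decoherent Hadamard-walk probabilities
`P_{m,n}(x,t) = Σ_{j∈𝔸^t} |⟨x,n|(A_{j_t}U)⋯(A_{j_1}U)|0,m⟩|²`. -/
def Pdec (p : ℝ) (m n : Fin 2) (x : ℤ) (t : ℕ) : ℝ :=
  ∑' j : Fin t → Option (ℤ × Fin 2), ‖pathAmp p m t j (x, n)‖ ^ 2

/-- `Ŵ_{m,n}(k,t) = Σ_x W_{m,n}(x,t) e^{ikx}`. -/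
def What (m n : Fin 2) (k : ℝ) (t : ℕ) : ℂ :=
  ∑' x : ℤ, (W m n x t : ℂ) * Complex.exp (Complex.I * k * x)

/-- `P̂_{m,n}(k,z) = Σ_{t≥0} Σ_x P_{m,n}(x,t) e^{ikx} z^t`. -/
def Phat (p : ℝ) (m n : Fin 2) (k : ℝ) (z : ℂ) : ℂ :=
  ∑' t : ℕ, (∑' x : ℤ, (Pdec p m n x t : ℂ) * Complex.exp (Complex.I * k * x)) * z ^ t

/-- `Q̂_{m,n}(k,z) = (p/q) Σ_{t≥1} Ŵ_{m,n}(k,t) (qz)^t = p Σ_{t≥1} Ŵ_{m,n}(k,t) q^{t-1} z^t`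
with `q = 1-p`. -/
def Qhat (p : ℝ) (m n : Fin 2) (k : ℝ) (z : ℂ) : ℂ :=
  (p : ℂ) * ∑' t : ℕ, What m n k (t + 1) * ((1 - p : ℝ) : ℂ) ^ t * z ^ (t + 1)

/-- The matrix `P(k,z) = (P̂_{m,n}(k,z))`. -/
def Pmat (p k : ℝ) (z : ℂ) : Matrix (Fin 2) (Fin 2) ℂ := Matrix.of fun m n => Phat p m n k z

/-- The matrix `Q(k,z) = (Q̂_{m,n}(k,z))`. -/
def Qmat (p k : ℝ) (z : ℂ) : Matrix (Fin 2) (Fin 2) ℂ := Matrix.of fun m n => Qhat p m n k z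

/-- Maximum row-sum norm of a 2×2 complex matrix. -/
def rowSumNorm (A : Matrix (Fin 2) (Fin 2) ℂ) : ℝ :=
  max (‖A 0 0‖ + ‖A 0 1‖) (‖A 1 0‖ + ‖A 1 1‖)

/-- Distribution of the symmetric decoherent Hadamard walk:
`P(X_t = x) = (1/2) Σ_{m,n} P_{m,n}(x,t)`. -/
def PsymProb (p : ℝ) (x : ℤ) (t : ℕ) : ℝ := (1/2) * ∑ m : Fin 2, ∑ n : Fin 2, Pdec p m n x t

/-- Mean position of the symmetric decoherent walk. -/
def symMean (p : ℝ) (t : ℕ) : ℝ := ∑' x : ℤ, (x : ℝ) * PsymProb p x t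

/-- Variance of the symmetric decoherent walk. -/
def symVar (p : ℝ) (t : ℕ) : ℝ :=
  (∑' x : ℤ, (x : ℝ) ^ 2 * PsymProb p x t) - (∑' x : ℤ, (x : ℝ) * PsymProb p x t) ^ 2

/-- The symmetric generating function `P̂(k,z) = (1/2) Σ_{m,n} P̂_{m,n}(k,z)`. -/
def PhatSym (p k : ℝ) (z : ℂ) : ℂ := (1/2) * ∑ m : Fin 2, ∑ n : Fin 2, Phat p m n k z

/-- Characteristic function `P̂(k,t)` of the symmetric decoherent walk. -/
def charSym (p k : ℝ) (t : ℕ) : ℂ :=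
  ∑' x : ℤ, (PsymProb p x t : ℂ) * Complex.exp (Complex.I * k * x)

/-- Distribution of the decoherent walk started at `|0,1⟩`: `P(X̃_t = x) = Σ_n P_{1,n}(x,t)`. -/
def Ptilde (p : ℝ) (x : ℤ) (t : ℕ) : ℝ := ∑ n : Fin 2, Pdec p 0 n x t

/-- Mean position of the decoherent walk started at `|0,1⟩`. -/
def tildeMean (p : ℝ) (t : ℕ) : ℝ := ∑' x : ℤ, (x : ℝ) * Ptilde p x t

/-- Variance of the decoherent walk started at `|0,1⟩`. -/
def tildeVar (p : ℝ) (t : ℕ) : ℝ :=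
  (∑' x : ℤ, (x : ℝ) ^ 2 * Ptilde p x t) - (∑' x : ℤ, (x : ℝ) * Ptilde p x t) ^ 2

/-- Characteristic function of the decoherent walk started at `|0,1⟩`. -/
def charTilde (p k : ℝ) (t : ℕ) : ℂ :=
  ∑' x : ℤ, (Ptilde p x t : ℂ) * Complex.exp (Complex.I * k * x)

/-- The symmetric initial state `φ₀ = (|0,1⟩ + i|0,2⟩)/√2`. -/
def phi0 : QState := fun v =>
  if v = ((0 : ℤ), (0 : Fin 2)) then (1 / Real.sqrt 2 : ℂ)
  else if v = ((0 : ℤ), (1 : Fin 2)) then Complex.I / Real.sqrt 2 else 0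

/-- Distribution of the pure symmetric Hadamard walk: `P(Q_t = x) = Σ_n |⟨x,n|U^t|φ₀⟩|²`. -/
def Ppure (x : ℤ) (t : ℕ) : ℝ := ∑ n : Fin 2, ‖(hadamardStep^[t] phi0) (x, n)‖ ^ 2

/-- Variance of the pure symmetric Hadamard walk. -/
def pureVar (t : ℕ) : ℝ :=
  (∑' x : ℤ, (x : ℝ) ^ 2 * Ppure x t) - (∑' x : ℤ, (x : ℝ) * Ppure x t) ^ 2

/-- `E(k,z) = √((q²z² − (1+cos k)qz + 1)(q²z² + (1+cos k)qz + 1))`, principal branch. -/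
def Efun (q k : ℝ) (z : ℂ) : ℂ :=
  (((q : ℂ) ^ 2 * z ^ 2 - (1 + (Real.cos k : ℂ)) * (q : ℂ) * z + 1) *
    ((q : ℂ) ^ 2 * z ^ 2 + (1 + (Real.cos k : ℂ)) * (q : ℂ) * z + 1)) ^ ((1 : ℂ) / 2)


/-- The site from which one step of the walk reaches `v`. -/
def source (v : ℤ × Fin 2) : ℤ := if v.2 = 0 then v.1 - 1 else v.1 + 1

/-- The sign with which the second coin component enters the Hadamard coin. -/
def coinSign (n : Fin 2) : ℝ := if n = 0 then 1 else -1

/-- The kernel of `U r U*` in terms of the real kernel `r`. -/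
def coinConj (r : ℤ × Fin 2 → ℤ × Fin 2 → ℝ) (v w : ℤ × Fin 2) : ℝ :=
  (r (source v, 0) (source w, 0) + coinSign w.2 * r (source v, 0) (source w, 1)
    + coinSign v.2 * r (source v, 1) (source w, 0)
    + coinSign v.2 * coinSign w.2 * r (source v, 1) (source w, 1)) / 2

/-- The density matrix of the decoherent walk started at `|0,1⟩`. -/
def density (q : ℝ) : ℕ → ℤ × Fin 2 → ℤ × Fin 2 → ℝ
  | 0, v, w => if v = (0, 0) ∧ w = (0, 0) then 1 else 0
  | t + 1, v, w => (if v = w then 1 else q) * coinConj (density q t) v w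

lemma hadamardStep_apply (ψ : QState) (v : ℤ × Fin 2) :
    hadamardStep ψ v = (ψ (source v, 0) + coinSign v.2 * ψ (source v, 1)) / (Real.sqrt 2 : ℂ) := by
  unfold hadamardStep source coinSign
  split_ifs <;> simp [sub_eq_add_neg]

lemma hasSum_of_eq {ι M : Type*} [AddCommMonoid M] [TopologicalSpace M] {f g : ι → M} {a b : M}
    (h : HasSum g b) (hfg : ∀ i, f i = g i) (hab : a = b) : HasSum f a := by
  rwa [funext hfg, hab]

lemma hasSum_ite_last {α M : Type*} [AddCommMonoid M] [TopologicalSpace M] [DecidableEq α]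
    {t : ℕ} {f : (Fin t → α) → M} {s : M} (hf : HasSum f s) (a : α) :
    HasSum (fun j : Fin (t + 1) → α =>
      if j (Fin.last t) = a then f (fun i => j i.castSucc) else 0) s := by
  have hinj : Function.Injective (fun j : Fin t → α => (Fin.snoc j a : Fin (t + 1) → α)) := by
    intro j j' h
    funext i
    simpa using congrFun h i.castSucc
  rw [← hinj.hasSum_iff]
  · simpa [Function.comp_def] using hf
  · intro j hj
    rw [if_neg]
    rintro rfl
    exact hj ⟨fun i => j i.castSucc, Fin.snoc_init_self j⟩

lemma hasSum_hadamardStep {ι : Type*} {ψ : ι → QState} {r : ℤ × Fin 2 → ℤ × Fin 2 → ℝ}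
    (h : ∀ v w, HasSum (fun j => ψ j v * (starRingEnd ℂ) (ψ j w)) (r v w : ℂ))
    (v w : ℤ × Fin 2) :
    HasSum (fun j => hadamardStep (ψ j) v * (starRingEnd ℂ) (hadamardStep (ψ j) w))
      (coinConj r v w : ℂ) := by
  have hs : (Real.sqrt 2 : ℂ) * Real.sqrt 2 = 2 := by
    rw [← Complex.ofReal_mul, Real.mul_self_sqrt (by norm_num)]; norm_num
  have key := ((((h (source v, 0) (source w, 0)).add
    ((h (source v, 0) (source w, 1)).mul_left (coinSign w.2 : ℂ))).add
    ((h (source v, 1) (source w, 0)).mul_left (coinSign v.2 : ℂ))).add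
    ((h (source v, 1) (source w, 1)).mul_left (coinSign v.2 * coinSign w.2 : ℂ))).div_const 2
  refine hasSum_of_eq key ?_ ?_
  · intro j
    simp only [hadamardStep_apply, map_div₀, map_add, map_mul, Complex.conj_ofReal]
    rw [div_mul_div_comm, hs]
    ring
  · simp [coinConj]

lemma hasSum_pathAmp_mul_conj {p : ℝ} (hp0 : 0 ≤ p) (hp1 : p ≤ 1) (t : ℕ) :
    ∀ v w, HasSum (fun j => pathAmp p 0 t j v * (starRingEnd ℂ) (pathAmp p 0 t j w))
      (density (1 - p) t v w : ℂ) := by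
  induction t with
  | zero =>
    intro v w
    refine hasSum_of_eq (hasSum_unique _) (fun _ => rfl) ?_
    simp only [pathAmp, ket, density]
    by_cases hv : v = (0, 0) <;> by_cases hw : w = (0, 0) <;> simp [hv, hw]
  | succ t ih =>
    intro v w
    have hs {x : ℝ} (hx : 0 ≤ x) : (Real.sqrt x : ℂ) * Real.sqrt x = x := by
      rw [← Complex.ofReal_mul, Real.mul_self_sqrt hx]
    have hU := hasSum_hadamardStep ih v w
    have key := ((hasSum_ite_last hU none).mul_left ((1 - p : ℝ) : ℂ)).add
      ((hasSum_ite_last hU (some v)).mul_left (if v = w then (p : ℂ) else 0))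
    refine hasSum_of_eq key ?_ ?_
    · intro j
      simp only [pathAmp]
      rcases hj : j (Fin.last t) with _ | u
      · simp only [measOp, map_mul, Complex.conj_ofReal, if_true, reduceCtorEq, if_false,
          mul_zero, add_zero]
        rw [mul_mul_mul_comm, hs (by linarith)]
      · simp only [measOp, reduceCtorEq, if_false, mul_zero, zero_add, Option.some.injEq]
        by_cases huv : v = u
        · subst huv
          by_cases hvw : w = v
          · subst hvw
            simp only [if_true, map_mul, Complex.conj_ofReal]
            rw [mul_mul_mul_comm, hs hp0]
          · simp [hvw, Ne.symm hvw]
        · simp [huv, Ne.symm huv]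
    · by_cases hvw : v = w
      · simp [density, hvw]; ring
      · simp [density, hvw]

lemma Pdec_zero_eq_density {p : ℝ} (hp0 : 0 ≤ p) (hp1 : p ≤ 1) (n : Fin 2) (x : ℤ) (t : ℕ) :
    Pdec p 0 n x t = density (1 - p) t (x, n) (x, n) := by
  have h := hasSum_pathAmp_mul_conj hp0 hp1 t (x, n) (x, n)
  simp only [Complex.mul_conj, Complex.normSq_eq_norm_sq] at h
  exact (Complex.hasSum_ofReal.mp h).tsum_eq

lemma density_eq_zero (q : ℝ) (t : ℕ) :
    ∀ v w : ℤ × Fin 2, (t : ℤ) < |v.1| → density q t v w = 0 := by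
  induction t with
  | zero =>
    intro v w h
    have : v ≠ (0, 0) := by rintro rfl; simp at h
    simp [density, this]
  | succ t ih =>
    intro v w h
    have h' : (t : ℤ) < |source v| := by
      push_cast at h
      unfold source
      split_ifs
      · have := abs_sub_abs_le_abs_sub v.1 (1 : ℤ)
        simp at this; omega
      · have := abs_sub_abs_le_abs_sub v.1 (-1 : ℤ)
        simp at this; omega
    simp [density, coinConj, ih (source v, _) _ h']

lemma summable_mul_density (q : ℝ) (t : ℕ) (f : ℤ → ℝ) (n : Fin 2) (g : ℤ → ℤ × Fin 2) :
    Summable (fun x => f x * density q t (x, n) (g x)) := by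
  refine summable_of_ne_finset_zero (s := Finset.Icc (-(t : ℤ)) t) fun x hx => ?_
  rw [density_eq_zero, mul_zero]
  rw [Finset.mem_Icc, ← abs_le] at hx
  simpa using hx

/-- The coefficients of the translation-averaged density matrix: the difference of the diagonal
entries and the two off-diagonal entries, at relative displacement `2 * d`. -/
def bloch (q : ℝ) : ℕ → ℤ → ℝ × ℝ × ℝ
  | 0, d => (if d = 0 then 1 else 0, 0, 0)
  | t + 1, d =>
    ((if d = 0 then 1 else q) * ((bloch q t d).2.1 + (bloch q t d).2.2),
      q * ((bloch q t (d + 1)).1 - (bloch q t (d + 1)).2.1 + (bloch q t (d + 1)).2.2) / 2,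
      q * ((bloch q t (d - 1)).1 + (bloch q t (d - 1)).2.1 - (bloch q t (d - 1)).2.2) / 2)

lemma hasSum_density (q : ℝ) (t : ℕ) : ∀ d : ℤ,
    HasSum (fun x : ℤ => density q t (x, 0) (x + 2 * d, 0) - density q t (x, 1) (x + 2 * d, 1))
      (bloch q t d).1 ∧
    HasSum (fun x : ℤ => density q t (x, 0) (x + 2 * d, 1)) (bloch q t d).2.1 ∧
    HasSum (fun x : ℤ => density q t (x, 1) (x + 2 * d, 0)) (bloch q t d).2.2 := by
  induction t with
  | zero =>
    intro d
    refine ⟨?_, ?_, ?_⟩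
    · refine hasSum_of_eq (hasSum_single (0 : ℤ) fun x hx => ?_) (fun _ => rfl) ?_
      · simp [density, hx]
      · by_cases hd : d = 0 <;> simp [density, bloch, hd]
    · simp [density, bloch]
    · simp [density, bloch]
  | succ t ih =>
    intro d
    have hS (n m : Fin 2) (e : ℤ) :
        Summable (fun x => density q t (x, n) (x + 2 * e, m)) := by
      simpa using summable_mul_density q t (fun _ => 1) n (fun x => (x + 2 * e, m))
    refine ⟨?_, ?_, ?_⟩
    · obtain ⟨-, hγ, hδ⟩ := ih d
      have h0 := ((hS 0 0 d).hasSum.add (hS 1 1 d).hasSum)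
      have hr := ((Equiv.subRight (1 : ℤ)).hasSum_iff.mpr (h0.add (hγ.add hδ))).mul_left
        ((if d = 0 then 1 else q) / 2)
      have hl := ((Equiv.addRight (1 : ℤ)).hasSum_iff.mpr (h0.sub (hγ.add hδ))).mul_left
        ((if d = 0 then 1 else q) / 2)
      refine hasSum_of_eq (hr.sub hl) ?_ ?_
      · intro x
        simp only [density, coinConj, source, coinSign, Function.comp_apply, Equiv.subRight_apply,
          Equiv.coe_addRight, if_true, one_ne_zero, if_false, Prod.mk.injEq, and_true,
          left_eq_add, mul_eq_zero, OfNat.ofNat_ne_zero, false_or]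
        rw [show x + 2 * d - 1 = x - 1 + 2 * d by ring, show x + 2 * d + 1 = x + 1 + 2 * d by ring]
        ring
      · simp only [bloch]; ring
    · obtain ⟨hβ, hγ, hδ⟩ := ih (d + 1)
      have hr := ((Equiv.subRight (1 : ℤ)).hasSum_iff.mpr ((hβ.sub hγ).add hδ)).mul_left (q / 2)
      refine hasSum_of_eq hr ?_ ?_
      · intro x
        simp only [density, coinConj, source, coinSign, Function.comp_apply, Equiv.subRight_apply,
          if_true, one_ne_zero, if_false, Prod.mk.injEq, and_false, zero_ne_one]
        rw [show x + 2 * d + 1 = x - 1 + 2 * (d + 1) by ring]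
        ring
      · simp only [bloch]; ring
    · obtain ⟨hβ, hγ, hδ⟩ := ih (d - 1)
      have hr := ((Equiv.addRight (1 : ℤ)).hasSum_iff.mpr ((hβ.add hγ).sub hδ)).mul_left (q / 2)
      refine hasSum_of_eq hr ?_ ?_
      · intro x
        simp only [density, coinConj, source, coinSign, Function.comp_apply, Equiv.coe_addRight,
          if_true, one_ne_zero, if_false, Prod.mk.injEq, and_false]
        rw [show x + 2 * d - 1 = x + 1 + 2 * (d - 1) by ring]
        ring
      · simp only [bloch]; ring

lemma tildeMean_eq {p : ℝ} (hp0 : 0 ≤ p) (hp1 : p ≤ 1) (t : ℕ) :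
    tildeMean p t = ∑' x : ℤ, (x * density (1 - p) t (x, 0) (x, 0)
      + x * density (1 - p) t (x, 1) (x, 1)) := by
  simp only [tildeMean, Ptilde, Fin.sum_univ_two, Pdec_zero_eq_density hp0 hp1, mul_add]

lemma tildeMean_zero {p : ℝ} (hp0 : 0 ≤ p) (hp1 : p ≤ 1) : tildeMean p 0 = 0 := by
  rw [tildeMean_eq hp0 hp1]
  refine (tsum_congr fun x => ?_).trans tsum_zero
  by_cases hx : x = 0 <;> simp [density, hx]

lemma tildeMean_succ {p : ℝ} (hp0 : 0 ≤ p) (hp1 : p ≤ 1) (t : ℕ) :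
    tildeMean p (t + 1) = tildeMean p t + (bloch (1 - p) (t + 1) 0).1 := by
  set q := 1 - p
  have hS (n m : Fin 2) : Summable (fun x : ℤ => density q t (x, n) (x, m)) := by
    simpa using summable_mul_density q t (fun _ => 1) n (fun x => (x, m))
  have hX (n m : Fin 2) : Summable (fun x : ℤ => (x : ℝ) * density q t (x, n) (x, m)) :=
    summable_mul_density q t (fun x => (x : ℝ)) n (fun x => (x, m))
  obtain ⟨-, hγ, hδ⟩ := hasSum_density q t 0
  simp only [mul_zero, add_zero] at hγ hδ
  have hM : HasSum (fun x : ℤ => x * density q t (x, 0) (x, 0) + x * density q t (x, 1) (x, 1))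
      (tildeMean p t) := by
    rw [tildeMean_eq hp0 hp1]; exact ((hX 0 0).add (hX 1 1)).hasSum
  have hm := (hX 0 1).hasSum.add (hX 1 0).hasSum
  have ha := (hS 0 0).hasSum.add (hS 1 1).hasSum
  have hg := hγ.add hδ
  have hr := (Equiv.subRight (1 : ℤ)).hasSum_iff.mpr
    ((((hM.add hm).add ha).add hg).div_const 2)
  have hl := (Equiv.addRight (1 : ℤ)).hasSum_iff.mpr
    ((((hM.sub hm).sub ha).add hg).div_const 2)
  rw [tildeMean_eq hp0 hp1]
  refine (HasSum.tsum_eq ?_)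
  refine hasSum_of_eq (hr.add hl) ?_ ?_
  · intro x
    simp only [density, coinConj, source, coinSign, Function.comp_apply, Equiv.subRight_apply,
      Equiv.coe_addRight, if_true, one_ne_zero, if_false]
    push_cast
    ring
  · simp only [bloch, if_true]; ring

lemma tsum_bloch_energy_le {q κ : ℝ} (hq0 : 0 ≤ q) (hqκ : q ≤ κ) (hκ1 : κ ≤ 1) (t : ℕ) :
    ∑' d : ℤ, ENNReal.ofReal (κ * (bloch q t d).1 ^ 2 / 2 + (bloch q t d).2.1 ^ 2
      + (bloch q t d).2.2 ^ 2) ≤ ENNReal.ofReal (κ ^ t) := by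
  have hκ0 : 0 ≤ κ := hq0.trans hqκ
  induction t with
  | zero =>
    rw [tsum_eq_single 0 (by intro d hd; simp [bloch, hd])]
    apply ENNReal.ofReal_le_ofReal
    simp only [bloch, if_true]
    linarith
  | succ t ih =>
    have hsplit (d : ℤ) : ENNReal.ofReal (κ * (bloch q (t + 1) d).1 ^ 2 / 2
        + (bloch q (t + 1) d).2.1 ^ 2 + (bloch q (t + 1) d).2.2 ^ 2)
        = ENNReal.ofReal (κ * (bloch q (t + 1) d).1 ^ 2 / 2)
        + ENNReal.ofReal ((bloch q (t + 1) d).2.1 ^ 2)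
        + ENNReal.ofReal ((bloch q (t + 1) d).2.2 ^ 2) := by
      rw [ENNReal.ofReal_add (by positivity) (by positivity),
        ENNReal.ofReal_add (by positivity) (by positivity)]
    simp_rw [hsplit]
    rw [ENNReal.tsum_add, ENNReal.tsum_add,
      ← (Equiv.subRight (1 : ℤ)).tsum_eq fun d => ENNReal.ofReal ((bloch q (t + 1) d).2.1 ^ 2),
      ← (Equiv.addRight (1 : ℤ)).tsum_eq fun d => ENNReal.ofReal ((bloch q (t + 1) d).2.2 ^ 2),
      ← ENNReal.tsum_add, ← ENNReal.tsum_add, pow_succ', ENNReal.ofReal_mul hκ0]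
    refine le_trans ?_ (mul_le_mul_right ih (ENNReal.ofReal κ))
    rw [← ENNReal.tsum_mul_left]
    refine ENNReal.tsum_le_tsum fun d => ?_
    rw [← ENNReal.ofReal_add (by positivity) (by positivity),
      ← ENNReal.ofReal_add (by positivity) (by positivity), ← ENNReal.ofReal_mul hκ0]
    apply ENNReal.ofReal_le_ofReal
    simp only [bloch, Equiv.subRight_apply, Equiv.coe_addRight, sub_add_cancel, add_sub_cancel_right]
    obtain ⟨β, γ, δ⟩ := bloch q t d
    have hc : (if d = 0 then 1 else q) ^ 2 ≤ 1 := by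
      split_ifs
      · norm_num
      · nlinarith
    have hqq : q ^ 2 ≤ κ ^ 2 := by gcongr
    have hκκ : κ ^ 2 ≤ κ := by nlinarith
    have h1 := mul_le_mul_of_nonneg_left hc (mul_nonneg hκ0 (sq_nonneg (γ + δ)))
    have h2 := mul_le_mul_of_nonneg_right hqq (sq_nonneg β)
    have h3 := mul_le_mul_of_nonneg_right (hqq.trans hκκ) (sq_nonneg (γ - δ))
    simp only
    nlinarith

lemma abs_bloch_le {q κ : ℝ} (hq0 : 0 ≤ q) (hqκ : q ≤ κ) (hκ : 1 / 2 ≤ κ) (hκ1 : κ ≤ 1)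
    (t : ℕ) (d : ℤ) :
    |(bloch q t d).1| ≤ 2 * Real.sqrt κ ^ t ∧ |(bloch q t d).2.1| ≤ 2 * Real.sqrt κ ^ t ∧
      |(bloch q t d).2.2| ≤ 2 * Real.sqrt κ ^ t := by
  have h := (ENNReal.le_tsum d).trans (tsum_bloch_energy_le hq0 hqκ hκ1 t)
  rw [ENNReal.ofReal_le_ofReal_iff (by positivity)] at h
  have hr : (2 * Real.sqrt κ ^ t) ^ 2 = 4 * κ ^ t := by
    rw [mul_pow, pow_right_comm, Real.sq_sqrt (by linarith)]; norm_num
  generalize bloch q t d = R at h ⊢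
  obtain ⟨β, γ, δ⟩ := R
  simp only at h ⊢
  have := mul_le_mul_of_nonneg_right hκ (sq_nonneg β)
  have h4 : 0 ≤ κ ^ t := by positivity
  refine ⟨?_, ?_, ?_⟩ <;> refine abs_le_of_sq_le_sq (hr ▸ ?_) (by positivity) <;>
    nlinarith [sq_nonneg β, sq_nonneg γ, sq_nonneg δ]

/-- Pairing of the averaged density matrix with the observable generated by `P`. -/
def correctorPairing (q : ℝ) (P : ℤ → ℝ) (t : ℕ) : ℝ :=
  ∑' d : ℤ, (((if d = 0 then 1 else 0) + q * (P d + P (-d)) / 2) * (bloch q t d).1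
    + P (d + 1) * (bloch q t d).2.1 + P (1 - d) * (bloch q t d).2.2)

section Corrector

variable {q κ : ℝ} {P : ℤ → ℝ}

lemma summable_correctorDiag (hP : Summable P) :
    Summable fun d : ℤ => (if d = 0 then (1 : ℝ) else 0) + q * (P d + P (-d)) / 2 := by
  refine .add ?_ (((hP.add ((Equiv.neg ℤ).summable_iff.mpr hP)).mul_left q).div_const 2)
  exact summable_of_ne_finset_zero (s := {0}) fun d hd => by simp at hd; simp [hd]

lemma correctorPairing_zero (hP0 : P 1 = 1 + q * P 0) : correctorPairing q P 0 = P 1 := by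
  unfold correctorPairing
  rw [tsum_eq_single 0 (by intro d hd; simp [bloch, hd])]
  simp only [bloch, if_true, neg_zero, zero_add, hP0]
  ring

lemma summable_corrector_mul {f g : ℤ → ℝ} {M : ℝ} (hf : Summable f) (hg : ∀ d, |g d| ≤ M) :
    Summable fun d => f d * g d :=
  (hf.abs.mul_right M).of_norm_bounded fun d => by
    rw [norm_mul, Real.norm_eq_abs, Real.norm_eq_abs]
    exact mul_le_mul_of_nonneg_left (hg d) (abs_nonneg _)

lemma correctorPairing_succ (hq0 : 0 ≤ q) (hq1 : q < 1) (hP : Summable P)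
    (hpoisson : ∀ d : ℤ, P (d + 1) = (if d = 0 then 1 else q) *
      ((if d = 0 then 1 else 0) + q * (P d + P (-d)) / 2) - q * (P d - P (-d)) / 2) (t : ℕ) :
    correctorPairing q P (t + 1) = correctorPairing q P t - (bloch q t 0).1 := by
  have hb (t : ℕ) (d : ℤ) := abs_bloch_le hq0 (show q ≤ 1 by linarith) (by norm_num) le_rfl t d
  have hR : Summable fun d : ℤ => P (d + 1) := (Equiv.addRight (1 : ℤ)).summable_iff.mpr hP
  have hL : Summable fun d : ℤ => P (1 - d) := (Equiv.subLeft (1 : ℤ)).summable_iff.mpr hP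
  have hA (t : ℕ) := summable_corrector_mul (summable_correctorDiag (q := q) hP)
    fun d => (hb t d).1
  have hB (t : ℕ) := summable_corrector_mul hR fun d => (hb t d).2.1
  have hC (t : ℕ) := summable_corrector_mul hL fun d => (hb t d).2.2
  have hE (t : ℕ) := ((hA t).add (hB t)).add (hC t) |>.hasSum
  have hE' := ((hA (t + 1)).hasSum.add
    ((Equiv.subRight (1 : ℤ)).hasSum_iff.mpr (hB (t + 1)).hasSum)).add
    ((Equiv.addRight (1 : ℤ)).hasSum_iff.mpr (hC (t + 1)).hasSum)
  have hsum : correctorPairing q P (t + 1) = _ :=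
    (((hA (t + 1)).hasSum.add (hB (t + 1)).hasSum).add (hC (t + 1)).hasSum).tsum_eq
  rw [hsum]
  have h0 : HasSum (fun d : ℤ => if d = 0 then (bloch q t d).1 else 0) (bloch q t 0).1 := by
    convert hasSum_single (0 : ℤ) _ using 1
    · simp
    · intro d hd; simp [hd]
  refine hE'.unique (hasSum_of_eq ((hE t).sub h0) (fun d => ?_) rfl)
  have h1 := hpoisson d
  have h2 := hpoisson (-d)
  simp only [neg_eq_zero, neg_neg, show -d + 1 = 1 - d by ring] at h2
  simp only [bloch, Function.comp_apply, Equiv.subRight_apply, Equiv.coe_addRight, sub_add_cancel,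
    add_sub_cancel_right, show 1 - (d + 1) = -d by ring]
  rw [h1, h2]
  split_ifs <;> ring

lemma abs_correctorPairing_le (hq0 : 0 ≤ q) (hqκ : q ≤ κ) (hκ : 1 / 2 ≤ κ) (hκ1 : κ ≤ 1)
    (hP : Summable P) : ∃ C > 0, ∀ t, |correctorPairing q P t| ≤ C * Real.sqrt κ ^ t := by
  have hR : Summable fun d : ℤ => P (d + 1) := (Equiv.addRight (1 : ℤ)).summable_iff.mpr hP
  have hL : Summable fun d : ℤ => P (1 - d) := (Equiv.subLeft (1 : ℤ)).summable_iff.mpr hP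
  have hD := summable_correctorDiag (q := q) hP
  obtain ⟨S, hS⟩ := (hD.abs.add hR.abs).add hL.abs
  have hS0 : 0 ≤ S := hS.nonneg fun d => by positivity
  refine ⟨2 * S + 1, by linarith, fun t => ?_⟩
  have hbound : |correctorPairing q P t| ≤ S * (2 * Real.sqrt κ ^ t) := by
    rw [correctorPairing, ← Real.norm_eq_abs]
    refine tsum_of_norm_bounded (hS.mul_right (2 * Real.sqrt κ ^ t)) fun d => ?_
    obtain ⟨h1, h2, h3⟩ := abs_bloch_le hq0 hqκ hκ hκ1 t d
    refine le_trans norm_add₃_le ?_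
    rw [norm_mul, norm_mul, norm_mul, add_mul, add_mul]
    simp only [Real.norm_eq_abs]
    gcongr
  have : 0 ≤ Real.sqrt κ ^ t := by positivity
  linarith

end Corrector

/-- A function on `ℤ` decaying geometrically on both sides of the origin. -/
def twoSidedGeom (a b l : ℝ) (d : ℤ) : ℝ :=
  if 0 < d then b * l ^ (d - 1).toNat else a * l ^ (-d).toNat

lemma twoSidedGeom_add_one (a b l : ℝ) (n : ℕ) : twoSidedGeom a b l (n + 1) = b * l ^ n := by
  rw [twoSidedGeom, if_pos (by omega)]; simp

lemma twoSidedGeom_neg (a b l : ℝ) (n : ℕ) : twoSidedGeom a b l (-n) = a * l ^ n := by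
  rw [twoSidedGeom, if_neg (by omega)]; simp

lemma summable_twoSidedGeom (a b : ℝ) {l : ℝ} (hl : |l| < 1) :
    Summable (twoSidedGeom a b l) := by
  have hgeom := summable_geometric_of_abs_lt_one hl
  refine .of_nat_of_neg ?_ ?_
  · rw [← summable_nat_add_iff 1]
    simpa [twoSidedGeom_add_one] using hgeom.mul_left b
  · simpa [twoSidedGeom_neg] using hgeom.mul_left a

lemma twoSidedGeom_poisson {q a b l : ℝ} (hb : b = 1 + q * a)
    (hpos : b * l = q ^ 2 * (b + a * l) / 2 - q * (b - a * l) / 2)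
    (hneg : a = q ^ 2 * (a * l + b) / 2 - q * (a * l - b) / 2) (d : ℤ) :
    twoSidedGeom a b l (d + 1) = (if d = 0 then 1 else q) *
      ((if d = 0 then 1 else 0) + q * (twoSidedGeom a b l d + twoSidedGeom a b l (-d)) / 2)
      - q * (twoSidedGeom a b l d - twoSidedGeom a b l (-d)) / 2 := by
  rcases lt_trichotomy d 0 with hd | rfl | hd
  · obtain ⟨n, rfl⟩ : ∃ n : ℕ, d = -((n + 1 : ℕ) : ℤ) := ⟨(-d - 1).toNat, by omega⟩
    rw [if_neg hd.ne, if_neg hd.ne, neg_neg, twoSidedGeom_neg,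
      show -((n + 1 : ℕ) : ℤ) + 1 = -(n : ℤ) by push_cast; ring, twoSidedGeom_neg, Nat.cast_add_one,
      twoSidedGeom_add_one]
    linear_combination l ^ n * hneg
  · have h0 := twoSidedGeom_neg a b l 0
    have h1 := twoSidedGeom_add_one a b l 0
    simp only [Nat.cast_zero, neg_zero, zero_add, pow_zero, mul_one] at h0 h1
    simp only [zero_add, neg_zero, h0, h1, if_true]
    linear_combination hb
  · obtain ⟨n, rfl⟩ : ∃ n : ℕ, d = ((n + 1 : ℕ) : ℤ) := ⟨(d - 1).toNat, by omega⟩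
    rw [if_neg hd.ne', if_neg hd.ne', twoSidedGeom_neg, twoSidedGeom_add_one, Nat.cast_add_one,
      twoSidedGeom_add_one]
    linear_combination l ^ n * hpos

lemma exists_corrector {q : ℝ} (hq0 : 0 ≤ q) (hq1 : q < 1) :
    ∃ a b l : ℝ, |l| < 1 ∧ b = 1 + q * a ∧ q * a = (Real.sqrt (1 + q ^ 2) - 1) / (1 - q) ∧
      b * l = q ^ 2 * (b + a * l) / 2 - q * (b - a * l) / 2 ∧
      a = q ^ 2 * (a * l + b) / 2 - q * (a * l - b) / 2 := by
  have hs : Real.sqrt (1 + q ^ 2) ^ 2 = 1 + q ^ 2 := Real.sq_sqrt (by positivity)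
  have hs0 : 0 ≤ Real.sqrt (1 + q ^ 2) := Real.sqrt_nonneg _
  generalize Real.sqrt (1 + q ^ 2) = s at hs hs0
  have h1 : 1 - q ≠ 0 := by linarith
  have h2 : s + 1 ≠ 0 := by positivity
  have hD : 0 < 1 + q + q ^ 2 + (1 + q) * s := by positivity
  refine ⟨q / ((1 - q) * (s + 1)), 1 + q * (q / ((1 - q) * (s + 1))),
    -q / (1 + q + q ^ 2 + (1 + q) * s), ?_, rfl, ?_, ?_, ?_⟩
  · rw [abs_div, abs_neg, abs_of_nonneg hq0, abs_of_pos hD, div_lt_one hD]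
    nlinarith [mul_nonneg (by linarith : 0 ≤ 1 + q) hs0]
  · field_simp
    linear_combination -hs
  · have := hD.ne'
    field_simp
    linear_combination (q - q ^ 2 - q ^ 3 + q ^ 4) * hs
  · have := hD.ne'
    field_simp
    linear_combination (-q - q ^ 2 + q ^ 3 + q ^ 4) * hs

/-- Long-term mean of the decoherent Hadamard walk started at `|0,1⟩`:
`μ_t = (√(1+q²) - 1)/p + O(e^{-dt})`. -/
theorem tilde_walk_mean_asymptotics (p q : ℝ)
    (hp0 : 0 < p) (hp1 : p ≤ 1) (hq : q = 1 - p) :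
    ∃ d > (0 : ℝ), ∃ C > (0 : ℝ), ∀ t : ℕ,
      |tildeMean p t - (Real.sqrt (1 + q ^ 2) - 1) / p| ≤ C * Real.exp (-d * t) := by
  have hq0 : 0 ≤ q := by linarith
  have hq1 : q < 1 := by linarith
  obtain ⟨a, b, l, hl, hb, hlim, hpos, hneg⟩ := exists_corrector hq0 hq1
  set P := twoSidedGeom a b l
  have hP : Summable P := summable_twoSidedGeom a b hl
  have hpoisson := twoSidedGeom_poisson hb hpos hneg
  have hP0 : P 0 = a := by simpa using twoSidedGeom_neg a b l 0
  have hP1 : P 1 = b := by simpa using twoSidedGeom_add_one a b l 0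
  have hE := correctorPairing_succ hq0 hq1 hP hpoisson
  have hE0 : correctorPairing q P 0 = b := by
    rw [correctorPairing_zero (by rw [hP0, hP1, hb]), hP1]
  have hmean (t : ℕ) : tildeMean p t = q * a - correctorPairing q P (t + 1) := by
    induction t with
    | zero => rw [tildeMean_zero hp0.le hp1, hE, hE0, hb]; simp [bloch]
    | succ t ih => rw [tildeMean_succ hp0.le hp1, ih, hE (t + 1), ← hq]; ring
  obtain ⟨C, hC, hbound⟩ := abs_correctorPairing_le (κ := (1 + q) / 2) hq0 (by linarith)
    (by linarith) (by linarith) hP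
  have hr0 : 0 < Real.sqrt ((1 + q) / 2) := Real.sqrt_pos.mpr (by linarith)
  have hr1 : Real.sqrt ((1 + q) / 2) < 1 := by
    rw [Real.sqrt_lt' one_pos]; linarith
  refine ⟨-Real.log (Real.sqrt ((1 + q) / 2)), by linarith [Real.log_neg hr0 hr1], C, hC,
    fun t => ?_⟩
  rw [neg_neg, mul_comm _ (t : ℝ), Real.exp_nat_mul, Real.exp_log hr0, hmean, hlim, hq,
    sub_sub_cancel, sub_sub_cancel_left, abs_neg, ← hq]
  refine (hbound (t + 1)).trans (mul_le_mul_of_nonneg_left ?_ hC.le)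
  exact pow_le_pow_of_le_one hr0.le hr1.le t.le_succ

end
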